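/- Let q : ℝ → ℝ be continuous, even, and τ-periodic for some τ > 0, and let w be the solution of w'' = q·w with w(0) = 1, w'(0) = 0. If the mean value (1/τ)·∫₀^τ q(t) dt is negative, then there exists T > 0 such that w(T) = 0. -/

import Mathlib

open Real intervalIntegral

/-- A function on `[a, ∞)` that is at least `1` cannot satisfy the Riccati inequality `K' ≥ K ^ 2`,
as its solutions blow up in finite time. -/
theorem not_sq_le_deriv_of_one_le {K K' : ℝ → ℝ} {a : ℝ}
    (hK : ∀ t ≥ a, HasDerivAt K (K' t) t) (hone : ∀ t ≥ a, 1 ≤ K t)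
    (hsq : ∀ t ≥ a, K t ^ 2 ≤ K' t) : False := by
  have hpos : ∀ t ≥ a, 0 < K t := fun t ht => one_pos.trans_le (hone t ht)
  have hd : ∀ t ≥ a, HasDerivAt (fun s => -(K s)⁻¹ - s) (-(-K' t / K t ^ 2) - 1) t :=
    fun t ht => ((hK t ht).inv (hpos t ht).ne').neg.sub (hasDerivAt_id t)
  have hmono : MonotoneOn (fun s => -(K s)⁻¹ - s) (Set.Ici a) := by
    refine monotoneOn_of_hasDerivWithinAt_nonneg (convex_Ici a)
      (fun t ht => (hd t ht).continuousAt.continuousWithinAt)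
      (fun t ht => (hd t (interior_subset ht)).hasDerivWithinAt) fun t ht => ?_
    have ht' : a ≤ t := interior_subset ht
    have := (one_le_div (pow_pos (hpos t ht') 2)).2 (hsq t ht')
    rw [neg_div]
    linarith
  have h := hmono (Set.mem_Ici.2 le_rfl) (Set.mem_Ici.2 (by linarith : a ≤ a + 1))
    (by linarith)
  have h₁ := inv_le_one_of_one_le₀ (hone a le_rfl)
  have h₂ := inv_pos.2 (hpos (a + 1) (by linarith))
  simp only at h
  linarith

/-- The primitive of a periodic function of negative mean tends to `-∞`. -/
theorem tendsto_atBot_primitive_of_integral_period_neg {q : ℝ → ℝ} {τ : ℝ} (hτ : 0 < τ)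
    (hper : Function.Periodic q τ) (hneg : ∫ t in (0 : ℝ)..τ, q t < 0) :
    Filter.Tendsto (fun t => ∫ s in (0 : ℝ)..t, q s) Filter.atTop Filter.atBot := by
  have hper' : Function.Periodic (fun t => -q t) τ := fun t => by simp only [hper t]
  have h := hper'.tendsto_atTop_intervalIntegral_of_pos
    (by rw [intervalIntegral.integral_neg]; linarith) hτ
  simpa only [intervalIntegral.integral_neg, Filter.tendsto_neg_atTop_iff] using h



/-- Hill equation: if the mean of `q` over a period is negative, the even
principal solution `w` (with `w 0 = 1`, `w' 0 = 0`) vanishes somewhere. -/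
theorem hill_even_solution_vanishes (q w : ℝ → ℝ) (τ : ℝ) (hτ : 0 < τ)
    (hq_cont : Continuous q) (hq_even : ∀ t, q (-t) = q t)
    (hq_per : ∀ t, q (t + τ) = q t)
    (hw : ContDiff ℝ 2 w)
    (hode : ∀ t, deriv (deriv w) t = q t * w t)
    (hw0 : w 0 = 1) (hw'0 : deriv w 0 = 0)
    (hmean : (1 / τ) * ∫ t in (0:ℝ)..τ, q t < 0) :
    ∃ T > 0, w T = 0 := by
  by_contra! hne
  have hpos : ∀ t ≥ 0, 0 < w t := by
    intro t ht
    by_contra! hle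
    obtain ⟨s, hs, hws⟩ := intermediate_value_Icc' ht hw.continuous.continuousOn
      (⟨hle, by rw [hw0]; exact zero_le_one⟩ : (0 : ℝ) ∈ Set.Icc (w t) (w 0))
    rcases hs.1.eq_or_lt with rfl | hs0
    · exact one_ne_zero (hw0.symm.trans hws)
    · exact hne s hs0 hws
  have hneg : ∫ t in (0 : ℝ)..τ, q t < 0 :=
    (pos_iff_neg_of_mul_neg hmean).1 (one_div_pos.2 hτ)
  have hdw : ∀ t, HasDerivAt w (deriv w t) t :=
    fun t => (hw.differentiable (by norm_num) t).hasDerivAt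
  have hddw : ∀ t, HasDerivAt (deriv w) (q t * w t) t := fun t =>
    hode t ▸ (((contDiff_succ_iff_deriv (n := 1)).1 hw).2.2.differentiable
      (by norm_num) t).hasDerivAt
  set H : ℝ → ℝ := fun t => (∫ s in (0 : ℝ)..t, q s) - deriv w t / w t with hH
  have hdH : ∀ t ≥ 0, HasDerivAt H ((deriv w t / w t) ^ 2) t := by
    intro t ht
    have hwt := (hpos t ht).ne'
    have h := (hq_cont.integral_hasStrictDerivAt 0 t).hasDerivAt.sub
      ((hddw t).div (hdw t) hwt)
    refine h.congr_deriv ?_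
    field_simp
    ring
  have hmono : MonotoneOn H (Set.Ici 0) :=
    monotoneOn_of_hasDerivWithinAt_nonneg (convex_Ici 0)
      (fun t ht => (hdH t ht).continuousAt.continuousWithinAt)
      (fun t ht => (hdH t (interior_subset ht)).hasDerivWithinAt) fun t _ => sq_nonneg _
  have hH_nonneg : ∀ t ≥ 0, 0 ≤ H t := fun t ht => by
    simpa [hH, hw'0] using hmono (Set.mem_Ici.2 le_rfl) (Set.mem_Ici.2 ht) ht
  obtain ⟨a, ha⟩ := Filter.eventually_atTop.1
    ((tendsto_atBot_primitive_of_integral_period_neg hτ hq_per hneg).eventually_le_atBot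
      (-1))
  refine not_sq_le_deriv_of_one_le (K := fun t => H t + 1) (a := max a 0)
    (fun t ht => (hdH t (le_of_max_le_right ht)).add_const 1)
    (fun t ht => by linarith [hH_nonneg t (le_of_max_le_right ht)]) fun t ht => ?_
  have h₁ := hH_nonneg t (le_of_max_le_right ht)
  have h₂ := ha t (le_of_max_le_left ht)
  have h₃ : H t + 1 ≤ -(deriv w t / w t) := by
    simp only [hH]
    linarith
  rw [← neg_sq (deriv w t / w t)]
  exact pow_le_pow_left₀ (by linarith) h₃ 2
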